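/- For all integers 1 ≤ n < k < ∞, twice the Gromov–Hausdorff distance between S^n and S^k is at most πk/(k+1); equivalently, π − 2 d_GH(S^n, S^k) ≥ π/(k+1). -/

import Mathlib

open Real

noncomputable section

/-- Euclidean space ℝ^d. -/
abbrev Euc (d : ℕ) : Type := EuclideanSpace ℝ (Fin d)

/-- The unit sphere S^n = {x ∈ ℝ^{n+1} : ⟨x,x⟩ = 1}. -/
def usphere (n : ℕ) : Set (Euc (n+1)) := {x | @inner ℝ _ _ x x = (1:ℝ)}

/-- The geodesic distance d(x,y) = arccos⟨x,y⟩. -/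
def geoDist {d : ℕ} (x y : Euc d) : ℝ := Real.arccos (@inner ℝ _ _ x y)

/-- A correspondence between A ⊆ ℝ^{d₁} and B ⊆ ℝ^{d₂}: a relation R ⊆ A × B whose
coordinate projections to A and B are both surjective. -/
def IsCorrespondence {d₁ d₂ : ℕ} (A : Set (Euc d₁)) (B : Set (Euc d₂))
    (R : Set (Euc d₁ × Euc d₂)) : Prop :=
  (∀ z ∈ R, z.1 ∈ A ∧ z.2 ∈ B) ∧
  (∀ a ∈ A, ∃ b ∈ B, (a, b) ∈ R) ∧
  (∀ b ∈ B, ∃ a ∈ A, (a, b) ∈ R)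

/-- The distortion of a relation, with respect to the geodesic metrics:
dis(R) = sup |d(x,x') − d(y,y')| over (x,y), (x',y') ∈ R. -/
def distortion {d₁ d₂ : ℕ} (R : Set (Euc d₁ × Euc d₂)) : ℝ :=
  sSup {t | ∃ z ∈ R, ∃ w ∈ R, t = |geoDist z.1 w.1 - geoDist z.2 w.2|}

/-- Twice the Gromov–Hausdorff distance between S^n and S^k (geodesic metrics),
via the Kalton–Ostrovskii formula: the infimum of dis(R) over all correspondences R. -/
def twoGH (n k : ℕ) : ℝ :=
  sInf {t | ∃ R : Set (Euc (n+1) × Euc (k+1)),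
    IsCorrespondence (usphere n) (usphere k) R ∧ t = distortion R}

open InnerProductGeometry

/-- `v j` is, up to ties, the member of the family `v` closest to `x`. -/
def IsNearest {J V : Type*} [NormedAddCommGroup V] [InnerProductSpace ℝ V]
    (v : J → V) (j : J) (x : V) : Prop :=
  ∀ i, angle x (v j) ≤ angle x (v i)

/-- A family of unit vectors, closed under negation, that is `δ`-separated and whose closed angular
balls of radius `π / 2 - δ / 2` cover the unit sphere. -/
structure IsAntipodalNet {J V : Type*} [NormedAddCommGroup V] [InnerProductSpace ℝ V]
    (δ : ℝ) (neg : J → J) (v : J → V) : Prop where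
  norm_eq : ∀ j, ‖v j‖ = 1
  map_neg : ∀ j, v (neg j) = -v j
  separated : ∀ i j, i ≠ j → δ ≤ angle (v i) (v j)
  covers : ∀ x, ‖x‖ = 1 → ∃ j, angle x (v j) ≤ π / 2 - δ / 2

/-- The relation that matches each vector of one net with the cell of the vector of the same index
in the other net. -/
def netRelation {J V W : Type*} [NormedAddCommGroup V] [InnerProductSpace ℝ V]
    [NormedAddCommGroup W] [InnerProductSpace ℝ W] (v : J → V) (w : J → W) : Set (V × W) :=
  {z | ‖z.1‖ = 1 ∧ ‖z.2‖ = 1 ∧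
    ∃ j, (IsNearest v j z.1 ∧ z.2 = w j) ∨ (z.1 = v j ∧ IsNearest w j z.2)}

section Nets

variable {J V W : Type*} [NormedAddCommGroup V] [InnerProductSpace ℝ V]
  [NormedAddCommGroup W] [InnerProductSpace ℝ W] {δ : ℝ} {neg : J → J} {v : J → V} {w : J → W}

lemma exists_isNearest [Finite J] [Nonempty J] (v : J → V) (x : V) : ∃ j, IsNearest v j x :=
  Finite.exists_min fun j => angle x (v j)

namespace IsAntipodalNet

lemma isNearest_neg (hv : IsAntipodalNet δ neg v) {j : J} {x : V} (h : IsNearest v j x) :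
    IsNearest v (neg j) (-x) := by
  intro i
  have h1 := h (neg i)
  rw [hv.map_neg, angle_neg_right] at h1
  rw [hv.map_neg, angle_neg_neg, angle_neg_left]
  exact h1

lemma angle_le_of_isNearest (hv : IsAntipodalNet δ neg v) {j : J} {x : V} (hx : ‖x‖ = 1)
    (h : IsNearest v j x) : angle x (v j) ≤ π / 2 - δ / 2 := by
  obtain ⟨i, hi⟩ := hv.covers x hx
  exact (h i).trans hi

lemma half_le_angle (hv : IsAntipodalNet δ neg v) {i j : J} {x : V} (h : IsNearest v i x)
    (hij : i ≠ j) : δ / 2 ≤ angle x (v j) := by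
  have h1 := hv.separated i j hij
  have h2 := angle_le_angle_add_angle (v i) x (v j)
  rw [angle_comm (v i) x] at h2
  linarith [h j]

/-- Two points of the same cell are at angle at most `π - δ`. -/
lemma angle_le_of_isNearest_of_isNearest (hv : IsAntipodalNet δ neg v) {j : J} {x y : V}
    (hx : ‖x‖ = 1) (hy : ‖y‖ = 1) (hxj : IsNearest v j x) (hyj : IsNearest v j y) :
    angle x y ≤ π - δ := by
  have h1 := hv.angle_le_of_isNearest hx hxj
  have h2 := hv.angle_le_of_isNearest hy hyj
  have h3 := angle_le_angle_add_angle x (v j) y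
  rw [angle_comm (v j) y] at h3
  linarith

lemma le_angle_sub_angle_same (hv : IsAntipodalNet δ neg v) (hw : IsAntipodalNet δ neg w)
    {i j : J} {x x' : V} (hx : ‖x‖ = 1) (hx' : ‖x'‖ = 1) (hi : IsNearest v i x)
    (hj : IsNearest v j x') : δ - π ≤ angle x x' - angle (w i) (w j) := by
  by_cases hij : i = neg j
  · have h1 := hv.angle_le_of_isNearest_of_isNearest hx (by rwa [norm_neg])
      (hij ▸ hi) (hv.isNearest_neg hj)
    rw [angle_neg_right] at h1
    linarith [angle_le_pi (w i) (w j)]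
  · have h1 := hw.separated _ _ hij
    rw [hw.map_neg, angle_neg_right] at h1
    linarith [angle_nonneg x x']

lemma abs_angle_sub_angle_same (hv : IsAntipodalNet δ neg v) (hw : IsAntipodalNet δ neg w)
    {i j : J} {x x' : V} (hx : ‖x‖ = 1) (hx' : ‖x'‖ = 1) (hi : IsNearest v i x)
    (hj : IsNearest v j x') : |angle x x' - angle (w i) (w j)| ≤ π - δ := by
  have h1 := hv.le_angle_sub_angle_same hw hx hx' hi hj
  have h2 := hv.le_angle_sub_angle_same hw hx (by rwa [norm_neg]) hi (hv.isNearest_neg hj)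
  rw [hw.map_neg, angle_neg_right, angle_neg_right] at h2
  exact abs_le.2 ⟨by linarith, by linarith⟩

lemma le_angle_sub_angle_cross (hδ : δ ≤ π) (hv : IsAntipodalNet δ neg v)
    (hw : IsAntipodalNet δ neg w) {i j : J} {x : V} {y : W} (hx : ‖x‖ = 1) (hy : ‖y‖ = 1)
    (hi : IsNearest v i x) (hj : IsNearest w j y) :
    δ - π ≤ angle x (v j) - angle (w i) y := by
  by_cases hij : i = j
  · subst hij
    have h1 := hw.angle_le_of_isNearest hy hj
    rw [angle_comm] at h1
    linarith [angle_nonneg x (v i)]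
  by_cases hij' : j = neg i
  · subst hij'
    have h1 := hv.angle_le_of_isNearest hx hi
    rw [hv.map_neg, angle_neg_right]
    linarith [angle_le_pi (w i) y]
  · have h1 := hv.half_le_angle hi hij
    have h2 := hw.half_le_angle hj hij'
    rw [hw.map_neg, angle_neg_right, angle_comm] at h2
    linarith

lemma abs_angle_sub_angle_cross (hδ : δ ≤ π) (hv : IsAntipodalNet δ neg v)
    (hw : IsAntipodalNet δ neg w) {i j : J} {x : V} {y : W} (hx : ‖x‖ = 1) (hy : ‖y‖ = 1)
    (hi : IsNearest v i x) (hj : IsNearest w j y) :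
    |angle x (v j) - angle (w i) y| ≤ π - δ := by
  have h1 := le_angle_sub_angle_cross hδ hv hw hx hy hi hj
  have h2 := le_angle_sub_angle_cross hδ hv hw hx (by rwa [norm_neg]) hi (hw.isNearest_neg hj)
  rw [hv.map_neg, angle_neg_right, angle_neg_right] at h2
  exact abs_le.2 ⟨by linarith, by linarith⟩

/-- The distortion of the relation between two nets is at most `π - δ`. -/
lemma abs_angle_sub_angle_le (hδ : δ ≤ π) (hv : IsAntipodalNet δ neg v)
    (hw : IsAntipodalNet δ neg w) {z z' : V × W} (hz : z ∈ netRelation v w)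
    (hz' : z' ∈ netRelation v w) : |angle z.1 z'.1 - angle z.2 z'.2| ≤ π - δ := by
  obtain ⟨x, y⟩ := z
  obtain ⟨x', y'⟩ := z'
  obtain ⟨hx, hy, i, ⟨hi, hi'⟩ | ⟨hi', hi⟩⟩ := hz <;>
  obtain ⟨hx', hy', j, ⟨hj, hj'⟩ | ⟨hj', hj⟩⟩ := hz' <;>
  simp only at hx hy hx' hy' hi hi' hj hj' <;> simp only [hi', hj']
  · exact hv.abs_angle_sub_angle_same hw hx hx' hi hj
  · exact abs_angle_sub_angle_cross hδ hv hw hx hy' hi hj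
  · have h := abs_angle_sub_angle_cross hδ hv hw hx' hy hj hi
    rwa [angle_comm, angle_comm (w j)] at h
  · rw [abs_sub_comm]
    exact hw.abs_angle_sub_angle_same hv hy hy' hi hj

end IsAntipodalNet

end Nets

lemma sq_sin_half_le {N : ℕ} (hN : 2 ≤ N) : sin (π / N / 2) ^ 2 ≤ 1 / N := by
  have hN' : (2 : ℝ) ≤ N := by exact_mod_cast hN
  have hle : π / N ≤ π / 2 := by gcongr
  have h := one_sub_mul_le_cos (x := π / N) (by positivity) hle
  have h1 : cos (π / N) = 1 - 2 * sin (π / N / 2) ^ 2 := by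
    rw [sin_sq_eq_half_sub, mul_div_cancel₀ _ two_ne_zero]
    ring
  have h2 : 2 / π * (π / N) = 2 * (1 / N) := by field_simp
  linarith

/-- The lines spanned by `v`, oriented in both ways, form an antipodal net as soon as they are
separated and the analysis operator of `v` is bounded below by one. -/
lemma isAntipodalNet_sumElim {ι V : Type*} [Fintype ι] [NormedAddCommGroup V]
    [InnerProductSpace ℝ V] {v : ι → V} (hι : 2 ≤ Fintype.card ι) (hv : ∀ i, ‖v i‖ = 1)
    (hsep : ∀ i j, i ≠ j → |inner ℝ (v i) (v j)| ≤ cos (π / Fintype.card ι))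
    (hframe : ∀ x, ‖x‖ = 1 → 1 ≤ ∑ i, inner ℝ x (v i) ^ 2) :
    IsAntipodalNet (π / Fintype.card ι) Sum.swap (Sum.elim v fun i => -v i) := by
  have hN' : (2 : ℝ) ≤ Fintype.card ι := by exact_mod_cast hι
  have hle : π / Fintype.card ι ≤ π / 2 := by gcongr
  have hpos : 0 ≤ π / Fintype.card ι := by positivity
  have hangle : ∀ i j, i ≠ j → π / Fintype.card ι ≤ angle (v i) (v j) ∧
      π / Fintype.card ι ≤ π - angle (v i) (v j) := by
    intro i j hij
    have h := abs_le.1 (hsep i j hij)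
    have hcos : cos (angle (v i) (v j)) = inner ℝ (v i) (v j) := by
      rw [cos_angle, hv, hv]; simp
    constructor
    · by_contra! hlt
      have := cos_lt_cos_of_nonneg_of_le_pi (angle_nonneg (v i) (v j)) (by linarith) hlt
      linarith
    · by_contra! hlt
      have := cos_lt_cos_of_nonneg_of_le_pi (by linarith [angle_le_pi (v i) (v j)])
        (by linarith) hlt
      rw [cos_pi_sub] at this
      linarith
  refine ⟨?_, ?_, ?_, ?_⟩
  · rintro (i | i) <;> simp [hv]
  · rintro (i | i) <;> simp
  · have hne : ∀ i, v i ≠ 0 := fun i h => by simpa [h] using hv i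
    rintro (i | i) (j | j) hij <;>
      simp only [Sum.elim_inl, Sum.elim_inr, angle_neg_right, angle_neg_left]
    · exact (hangle i j (by simpa using hij)).1
    · by_cases h : i = j
      · subst h; rw [angle_self (hne i)]; linarith
      · exact (hangle i j h).2
    · by_cases h : i = j
      · subst h; rw [angle_self (hne i)]; linarith
      · exact (hangle i j h).2
    · rw [sub_sub_cancel]
      exact (hangle i j (by simpa using hij)).1
  · intro x hx
    obtain ⟨i, hi⟩ : ∃ i, 1 / (Fintype.card ι : ℝ) ≤ inner ℝ x (v i) ^ 2 := by
      by_contra! hlt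
      have : Nonempty ι := Fintype.card_pos_iff.1 (by omega)
      have := Finset.sum_lt_sum_of_nonempty Finset.univ_nonempty fun i _ => hlt i
      rw [Finset.sum_const, Finset.card_univ, nsmul_eq_mul, mul_one_div_cancel (by positivity)]
        at this
      linarith [hframe x hx]
    have hsin : sin (π / Fintype.card ι / 2) ≤ |inner ℝ x (v i)| :=
      le_of_sq_le_sq (by rw [sq_abs]; exact (sq_sin_half_le hι).trans hi) (abs_nonneg _)
    have key : ∀ u : V, ‖u‖ = 1 → sin (π / Fintype.card ι / 2) ≤ inner ℝ x u →
        angle x u ≤ π / 2 - π / Fintype.card ι / 2 := by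
      intro u hu h
      rw [← cos_pi_div_two_sub] at h
      by_contra! hlt
      have := cos_lt_cos_of_nonneg_of_le_pi (by linarith) (angle_le_pi x u) hlt
      rw [cos_angle, hx, hu] at this
      simp only [mul_one, div_one] at this
      linarith
    rcases le_abs.1 hsin with h | h
    · exact ⟨Sum.inl i, key _ (hv i) h⟩
    · exact ⟨Sum.inr i, key _ (by simpa using hv i) (by simpa using h)⟩

/-- An orthonormal basis, oriented in both ways, is an antipodal net. -/
lemma OrthonormalBasis.isAntipodalNet {ι V : Type*} [Fintype ι] [NormedAddCommGroup V]
    [InnerProductSpace ℝ V] (b : OrthonormalBasis ι ℝ V) (hι : 2 ≤ Fintype.card ι) :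
    IsAntipodalNet (π / Fintype.card ι) Sum.swap (Sum.elim b fun i => -b i) := by
  refine isAntipodalNet_sumElim hι b.norm_eq_one (fun i j hij => ?_) fun x hx => ?_
  · rw [b.orthonormal.2 hij, abs_zero]
    have hN' : (2 : ℝ) ≤ Fintype.card ι := by exact_mod_cast hι
    have hle : π / Fintype.card ι ≤ π / 2 := by gcongr
    exact cos_nonneg_of_mem_Icc
      ⟨by linarith [pi_pos, show 0 ≤ π / Fintype.card ι by positivity], hle⟩
  · have := b.sum_sq_inner_left x
    rw [hx, one_pow] at this
    exact this.ge

/-- `m` equally spaced lines in the plane of the first two basis vectors, together with the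
remaining basis vectors. -/
def fanVector {κ V : Type*} [Fintype κ] [NormedAddCommGroup V] [InnerProductSpace ℝ V]
    (m : ℕ) (b : OrthonormalBasis (Fin 2 ⊕ κ) ℝ V) : Fin m ⊕ κ → V :=
  Sum.elim (fun i => cos (π * i / m) • b (Sum.inl 0) + sin (π * i / m) • b (Sum.inl 1))
    fun j => b (Sum.inr j)

lemma sum_cos_sub_eq_zero {m : ℕ} (hm : 2 ≤ m) (φ : ℝ) :
    ∑ i : Fin m, cos (2 * (π * i / m) - φ) = 0 := by
  have hprim := (Complex.isPrimitiveRoot_exp m (by omega)).geom_sum_eq_zero (by omega)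
  have h : ∑ i ∈ Finset.range m, Complex.exp (((2 * (π * i / m) - φ : ℝ) : ℂ) * Complex.I) = 0 := by
    rw [← mul_zero (Complex.exp (-(φ : ℂ) * Complex.I)), ← hprim, Finset.mul_sum]
    refine Finset.sum_congr rfl fun i _ => ?_
    rw [← Complex.exp_nat_mul, ← Complex.exp_add]
    congr 1
    push_cast
    ring
  have h' := congrArg Complex.re h
  rw [Complex.re_sum] at h'
  simp only [Complex.exp_ofReal_mul_I_re, Complex.zero_re] at h'
  rw [Fin.sum_univ_eq_sum_range fun i : ℕ => cos (2 * (π * i / m) - φ)]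
  exact h'

lemma abs_cos_le_cos_pi_div {m N i j : ℕ} (hmN : m ≤ N) (hi : i < m) (hj : j < m) (hij : i ≠ j) :
    |cos (π * i / m - π * j / m)| ≤ cos (π / N) := by
  wlog hlt : j < i generalizing i j
  · rw [← cos_neg, neg_sub]
    exact this hj hi hij.symm (by omega)
  have hm : (0 : ℝ) < m := by exact_mod_cast (by omega : 0 < m)
  have hNm : (m : ℝ) ≤ N := by exact_mod_cast hmN
  have h0 : π / N ≤ π / m := by gcongr
  have h1 : (j : ℝ) + 1 ≤ i := by exact_mod_cast hlt
  have h2 : (i : ℝ) + 1 ≤ m := by exact_mod_cast hi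
  have hlow : π / m ≤ π * i / m - π * j / m := by
    rw [← sub_div, ← mul_sub]
    gcongr
    nlinarith [pi_pos]
  have hup : π * i / m - π * j / m ≤ π - π / m := by
    rw [← sub_div, ← mul_sub, div_le_iff₀ hm, sub_mul, div_mul_cancel₀ _ hm.ne']
    nlinarith [pi_pos, mul_nonneg pi_pos.le (Nat.cast_nonneg (α := ℝ) j)]
  have hN : 0 ≤ π / N := by positivity
  rw [abs_le]
  constructor
  · rw [← cos_pi_sub]
    exact cos_le_cos_of_nonneg_of_le_pi (by linarith) (by linarith) (by linarith)
  · exact cos_le_cos_of_nonneg_of_le_pi hN (by linarith) (by linarith)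

section Fan

variable {κ V : Type*} [Fintype κ] [NormedAddCommGroup V] [InnerProductSpace ℝ V] {m : ℕ}
  (b : OrthonormalBasis (Fin 2 ⊕ κ) ℝ V)

lemma inner_fanVector_inl (i j : Fin m) :
    inner ℝ (fanVector m b (Sum.inl i)) (fanVector m b (Sum.inl j)) =
      cos (π * i / m - π * j / m) := by
  classical
  simp [fanVector, inner_add_left, inner_add_right, inner_smul_left, inner_smul_right,
    b.inner_eq_ite, cos_sub, mul_comm]

lemma norm_fanVector (i : Fin m ⊕ κ) : ‖fanVector m b i‖ = 1 := by
  rcases i with i | i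
  · have h := real_inner_self_eq_norm_sq (fanVector m b (Sum.inl i))
    rw [inner_fanVector_inl, sub_self, cos_zero] at h
    exact (pow_eq_one_iff_of_nonneg (norm_nonneg _) two_ne_zero).1 h.symm
  · exact b.norm_eq_one _

lemma sum_sq_inner_fanVector (hm : 2 ≤ m) (x : V) :
    ‖x‖ ^ 2 ≤ ∑ i, inner ℝ x (fanVector m b i) ^ 2 := by
  rw [← b.sum_sq_inner_left x, Fintype.sum_sum_type, Fintype.sum_sum_type]
  gcongr ?_ + ?_
  · simp only [fanVector, Sum.elim_inl, Fin.sum_univ_two, inner_add_right, inner_smul_right]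
    set p := inner ℝ x (b (Sum.inl 0))
    set q := inner ℝ x (b (Sum.inl 1))
    have hterm : ∀ t : ℝ, (cos t * p + sin t * q) ^ 2 = (p ^ 2 + q ^ 2) / 2 +
        (p ^ 2 - q ^ 2) / 2 * cos (2 * t - 0) + p * q * cos (2 * t - π / 2) := by
      intro t
      rw [cos_sub_pi_div_two, sub_zero, cos_two_mul, sin_two_mul]
      nlinarith [sin_sq_add_cos_sq t]
    have hm' : (2 : ℝ) ≤ m := by exact_mod_cast hm
    simp only [hterm, Finset.sum_add_distrib, ← Finset.mul_sum, sum_cos_sub_eq_zero hm]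
    simp only [Finset.sum_const, Finset.card_univ, Fintype.card_fin, nsmul_eq_mul]
    nlinarith [sq_nonneg p, sq_nonneg q]
  · exact le_rfl

/-- A fan, oriented in both ways, is an antipodal net. -/
lemma isAntipodalNet_fanVector (hm : 2 ≤ m) :
    IsAntipodalNet (π / Fintype.card (Fin m ⊕ κ)) Sum.swap
      (Sum.elim (fanVector m b) fun i => -fanVector m b i) := by
  classical
  have hcard : m ≤ Fintype.card (Fin m ⊕ κ) := by simp
  have hcos : 0 ≤ cos (π / Fintype.card (Fin m ⊕ κ)) := by
    have hN' : (2 : ℝ) ≤ Fintype.card (Fin m ⊕ κ) := by exact_mod_cast hm.trans hcard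
    have hle : π / Fintype.card (Fin m ⊕ κ) ≤ π / 2 := by gcongr
    exact cos_nonneg_of_mem_Icc
      ⟨by linarith [pi_pos, show 0 ≤ π / Fintype.card (Fin m ⊕ κ) by positivity], hle⟩
  refine isAntipodalNet_sumElim (hm.trans hcard) (norm_fanVector b) ?_ fun x hx => ?_
  · rintro (i | i) (j | j) hij
    · rw [inner_fanVector_inl]
      exact abs_cos_le_cos_pi_div hcard i.2 j.2 fun h => hij (congrArg _ (Fin.ext h))
    · simpa [fanVector, inner_add_left, inner_smul_left, b.inner_eq_ite] using hcos
    · simpa [fanVector, inner_add_right, inner_smul_right, b.inner_eq_ite] using hcos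
    · have h : i ≠ j := fun h => hij (congrArg _ h)
      simpa [fanVector, b.inner_eq_ite, h] using hcos
  · have h := sum_sq_inner_fanVector b hm x
    rwa [hx, one_pow] at h

end Fan

lemma mem_usphere_iff {n : ℕ} {x : Euc (n + 1)} : x ∈ usphere n ↔ ‖x‖ = 1 := by
  rw [usphere, Set.mem_ofPred_eq, real_inner_self_eq_norm_sq]
  exact pow_eq_one_iff_of_nonneg (norm_nonneg x) two_ne_zero

lemma geoDist_eq_angle {d : ℕ} {x y : Euc d} (hx : ‖x‖ = 1) (hy : ‖y‖ = 1) :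
    geoDist x y = angle x y := by
  rw [geoDist, angle, hx, hy, mul_one, div_one]

lemma isCorrespondence_netRelation {J : Type*} [Finite J] [Nonempty J] {n k : ℕ}
    {v : J → Euc (n + 1)} {w : J → Euc (k + 1)} (hv : ∀ j, ‖v j‖ = 1) (hw : ∀ j, ‖w j‖ = 1) :
    IsCorrespondence (usphere n) (usphere k) (netRelation v w) := by
  refine ⟨fun z hz => ⟨mem_usphere_iff.2 hz.1, mem_usphere_iff.2 hz.2.1⟩, fun x hx => ?_,
    fun y hy => ?_⟩
  · obtain ⟨j, hj⟩ := exists_isNearest v x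
    exact ⟨w j, mem_usphere_iff.2 (hw j), mem_usphere_iff.1 hx, hw j, j, Or.inl ⟨hj, rfl⟩⟩
  · obtain ⟨j, hj⟩ := exists_isNearest w y
    exact ⟨v j, mem_usphere_iff.2 (hv j), hv j, mem_usphere_iff.1 hy, j, Or.inr ⟨rfl, hj⟩⟩

lemma twoGH_le_distortion {n k : ℕ} {R : Set (Euc (n + 1) × Euc (k + 1))}
    (hR : IsCorrespondence (usphere n) (usphere k) R) : twoGH n k ≤ distortion R := by
  refine csInf_le ⟨0, ?_⟩ ⟨R, hR, rfl⟩
  rintro _ ⟨S, -, rfl⟩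
  refine Real.sSup_nonneg ?_
  rintro _ ⟨z, -, z', -, rfl⟩
  exact abs_nonneg _

lemma twoGH_le_of_isAntipodalNet {J : Type*} [Finite J] [Nonempty J] {n k : ℕ} {δ : ℝ}
    {neg : J → J} {v : J → Euc (n + 1)} {w : J → Euc (k + 1)} (hδ : δ ≤ π)
    (hv : IsAntipodalNet δ neg v) (hw : IsAntipodalNet δ neg w) : twoGH n k ≤ π - δ := by
  refine (twoGH_le_distortion (isCorrespondence_netRelation hv.norm_eq hw.norm_eq)).trans ?_
  refine Real.sSup_le ?_ (sub_nonneg.2 hδ)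
  rintro _ ⟨z, hz, z', hz', rfl⟩
  rw [geoDist_eq_angle hz.1 hz'.1, geoDist_eq_angle hz.2.1 hz'.2.1]
  exact IsAntipodalNet.abs_angle_sub_angle_le hδ hv hw hz hz'

/-- For all 1 ≤ n < k < ∞, 2 d_GH(S^n, S^k) ≤ πk/(k+1); equivalently
π − 2 d_GH(S^n, S^k) ≥ π/(k+1). -/
theorem two_dGH_le (n k : ℕ) (hn : 1 ≤ n) (hnk : n < k) :
    twoGH n k ≤ π * k / ((k : ℝ) + 1) ∧ π / ((k : ℝ) + 1) ≤ π - twoGH n k := by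
  suffices h : twoGH n k ≤ π - π / ((k : ℝ) + 1) by
    refine ⟨h.trans_eq ?_, by linarith⟩
    field_simp
    ring
  obtain ⟨a, rfl⟩ := Nat.exists_eq_add_of_le hn
  obtain ⟨c, rfl⟩ := Nat.exists_eq_add_of_lt hnk
  have hcard : Fintype.card (Fin (c + 3) ⊕ Fin a) = 1 + a + c + 1 + 1 := by
    simp only [Fintype.card_sum, Fintype.card_fin]
    ring
  have hb : Fintype.card (Fin (1 + a + 1)) = Fintype.card (Fin 2 ⊕ Fin a) := by
    simp only [Fintype.card_sum, Fintype.card_fin]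
    ring
  let b := (EuclideanSpace.basisFun (Fin (1 + a + 1)) ℝ).reindex (Fintype.equivOfCardEq hb)
  let e := (EuclideanSpace.basisFun (Fin (1 + a + c + 1 + 1)) ℝ).reindex
    (Fintype.equivOfCardEq (by rw [hcard, Fintype.card_fin]))
  have hv := isAntipodalNet_fanVector (m := c + 3) b (by omega)
  have hw := e.isAntipodalNet (by omega)
  have hle : π / (Fintype.card (Fin (c + 3) ⊕ Fin a) : ℝ) ≤ π :=
    div_le_self pi_pos.le (by rw [hcard]; exact_mod_cast (by omega))
  have h := twoGH_le_of_isAntipodalNet hle hv hw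
  rw [hcard] at h
  exact_mod_cast h
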